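/- Assume Θ is compact and g(x,β) is twice differentiable with respect to β for all x. For the normal–truncated-normal pseudo conditional density and for the normal–exponential pseudo conditional density, for every α > 0 there exists a constant C such that for all θ ∈ Θ and all (x,y): f_θ^{α−1}(y|x) · ‖∂²_{θθᵀ} f_θ(y|x)‖ ≤ C (1 + sup_{θ∈Θ} ‖∂_β g(x,β) ∂_{βᵀ} g(x,β)‖ + sup_{θ∈Θ} ‖∂²_{ββᵀ} g(x,β)‖). -/

import Mathlib

open MeasureTheory ProbabilityTheory Real Set Filter
open scoped ENNReal NNReal

/-- The standard normal density φ(t) = (2π)^{-1/2} e^{-t²/2}. -/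
noncomputable def stdGaussPdf (t : ℝ) : ℝ := (Real.sqrt (2 * Real.pi))⁻¹ * Real.exp (-(t ^ 2) / 2)

/-- The standard normal cumulative distribution function Φ. -/
noncomputable def stdGaussCdf (t : ℝ) : ℝ := ∫ s in Set.Iic t, stdGaussPdf s

/-- The normal–truncated-normal pseudo conditional density
f_θ(y|x) = (1/σ)[1−Φ(−μ/σ_u)]⁻¹ φ((y−g(x,β)+μ)/σ) Φ(μ/(σλ) − λ(y−g(x,β))/σ),
with σ² = σ_v² + σ_u², λ = σ_u/σ_v, and θ = (β, μ, σ_v, σ_u). -/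
noncomputable def fNT {p q : ℕ} (g : (Fin p → ℝ) → (Fin q → ℝ) → ℝ)
    (θ : (Fin q → ℝ) × ℝ × ℝ × ℝ) (x : Fin p → ℝ) (y : ℝ) : ℝ :=
  let β := θ.1; let μ := θ.2.1; let σv := θ.2.2.1; let σu := θ.2.2.2
  let σ := Real.sqrt (σv ^ 2 + σu ^ 2)
  let lam := σu / σv
  σ⁻¹ * (1 - stdGaussCdf (-(μ / σu)))⁻¹ * stdGaussPdf ((y - g x β + μ) / σ) *
    stdGaussCdf (μ / (σ * lam) - lam * (y - g x β) / σ)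

/-- The normal–exponential pseudo conditional density
f_θ(y|x) = (1/σ_u) Φ(−(y−g(x,β))/σ_v − σ_v/σ_u) exp((y−g(x,β))/σ_u + σ_v²/(2σ_u²)),
with θ = (β, σ_v, σ_u). -/
noncomputable def fNE {p q : ℕ} (g : (Fin p → ℝ) → (Fin q → ℝ) → ℝ)
    (θ : (Fin q → ℝ) × ℝ × ℝ) (x : Fin p → ℝ) (y : ℝ) : ℝ :=
  let β := θ.1; let σv := θ.2.1; let σu := θ.2.2
  σu⁻¹ * stdGaussCdf (-((y - g x β) / σv) - σv / σu) *
    Real.exp ((y - g x β) / σu + σv ^ 2 / (2 * σu ^ 2))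

/-- The objective function H_α(x,y;θ) = ∫ f_θ^{1+α}(y'|x) dy' − (1+1/α) f_θ^α(y|x)
of the minimum density power divergence estimator. -/
noncomputable def dpdH {P XS : Type*} (a : ℝ) (f : P → XS → ℝ → ℝ)
    (θ : P) (x : XS) (y : ℝ) : ℝ :=
  (∫ y' : ℝ, f θ x y' ^ (1 + a)) - (1 + 1 / a) * f θ x y ^ a

/-- The compact parameter box Θ = [b̲,b̄]^q × [u̲,ū] × [σ̲,σ̄]² of the
normal–truncated-normal specification. -/
def boxNT (q : ℕ) (bl bu ul uu sl su : ℝ) : Set ((Fin q → ℝ) × ℝ × ℝ × ℝ) :=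
  (Set.Icc (fun _ => bl) (fun _ => bu)) ×ˢ ((Set.Icc ul uu) ×ˢ ((Set.Icc sl su) ×ˢ (Set.Icc sl su)))

/-- The compact parameter box Θ = [b̲,b̄]^q × [σ̲,σ̄]² of the normal–exponential
specification. -/
def boxNE (q : ℕ) (bl bu sl su : ℝ) : Set ((Fin q → ℝ) × ℝ × ℝ) :=
  (Set.Icc (fun _ => bl) (fun _ => bu)) ×ˢ ((Set.Icc sl su) ×ˢ (Set.Icc sl su))

theorem stdGaussPdf_pos (t : ℝ) : 0 < stdGaussPdf t := by
  unfold stdGaussPdf; positivity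

theorem hasDerivAt_stdGaussPdf (t : ℝ) : HasDerivAt stdGaussPdf (-(t * stdGaussPdf t)) t := by
  have h : HasDerivAt (fun t : ℝ => -(t ^ 2) / 2) (-t) t := by
    have := ((hasDerivAt_pow 2 t).neg).div_const 2
    exact this.congr_deriv (by push_cast; ring)
  have h2 := h.exp.const_mul ((Real.sqrt (2 * Real.pi))⁻¹)
  exact h2.congr_deriv (by unfold stdGaussPdf; ring)

theorem contDiff_stdGaussPdf {n : WithTop ℕ∞} : ContDiff ℝ n stdGaussPdf := by
  unfold stdGaussPdf; fun_prop

theorem stdGaussPdf_eq_gaussianPDFReal : stdGaussPdf = gaussianPDFReal 0 1 := by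
  ext t
  simp [stdGaussPdf, gaussianPDFReal]

theorem integrable_stdGaussPdf : Integrable stdGaussPdf := by
  rw [stdGaussPdf_eq_gaussianPDFReal]; exact integrable_gaussianPDFReal 0 1

theorem integral_stdGaussPdf : ∫ t, stdGaussPdf t = 1 := by
  rw [stdGaussPdf_eq_gaussianPDFReal]; exact integral_gaussianPDFReal_eq_one 0 one_ne_zero

theorem hasDerivAt_stdGaussCdf (t : ℝ) : HasDerivAt stdGaussCdf (stdGaussPdf t) t := by
  have h : stdGaussCdf = fun t => stdGaussCdf 0 + ∫ s in (0 : ℝ)..t, stdGaussPdf s := by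
    ext t
    rw [← intervalIntegral.integral_Iic_sub_Iic integrable_stdGaussPdf.integrableOn
      integrable_stdGaussPdf.integrableOn]
    unfold stdGaussCdf; ring
  rw [h]
  refine HasDerivAt.const_add _ ?_
  have hc : Continuous stdGaussPdf := (contDiff_stdGaussPdf (n := 0)).continuous
  exact hc.integral_hasStrictDerivAt 0 t |>.hasDerivAt

theorem contDiff_stdGaussCdf : ContDiff ℝ 2 stdGaussCdf := by
  have h : deriv stdGaussCdf = stdGaussPdf := funext fun t => (hasDerivAt_stdGaussCdf t).deriv
  have : ContDiff ℝ (1 + 1) stdGaussCdf := by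
    rw [contDiff_succ_iff_deriv]
    refine ⟨fun t => (hasDerivAt_stdGaussCdf t).differentiableAt, by simp, ?_⟩
    rw [h]; exact contDiff_stdGaussPdf
  simpa [one_add_one_eq_two] using this

/-- A lower form of the Mills ratio inequality, valid on the whole line. -/
theorem stdGaussPdf_le_mul_stdGaussCdf (t : ℝ) :
    stdGaussPdf t ≤ Real.exp (3 / 2) * (1 + |t|) * stdGaussCdf t := by
  have hpos : 0 < 1 + |t| := by positivity
  set d := (1 + |t|)⁻¹ with hd
  have hd0 : 0 < d := by positivity
  have hdt : d * (1 + |t|) = 1 := inv_mul_cancel₀ hpos.ne'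
  have hd1 : d ≤ 1 := by nlinarith [abs_nonneg t]
  have key : ∀ s ∈ Set.Icc (t - d) t, Real.exp (-(3 / 2)) * stdGaussPdf t ≤ stdGaussPdf s := by
    intro s hs
    unfold stdGaussPdf
    rw [mul_left_comm, ← Real.exp_add]
    gcongr
    have h1 : s ^ 2 ≤ t ^ 2 + 3 := by
      have h2 : 0 ≤ t - s := by linarith [hs.2]
      have h3 : t - s ≤ d := by linarith [hs.1]
      have h4 : s ^ 2 = t ^ 2 - 2 * t * (t - s) + (t - s) ^ 2 := by ring
      have h5 : -(2 * t * (t - s)) ≤ 2 * (|t| * d) := by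
        have : -t * (t - s) ≤ |t| * d :=
          mul_le_mul (neg_le_abs t) h3 h2 (abs_nonneg t)
        linarith
      nlinarith
    linarith
  have h1 : ∫ s in Set.Icc (t - d) t, Real.exp (-(3 / 2)) * stdGaussPdf t ≤
      ∫ s in Set.Icc (t - d) t, stdGaussPdf s :=
    setIntegral_mono_on (integrableOn_const (by simp)) integrable_stdGaussPdf.integrableOn
      measurableSet_Icc key
  have h2 : ∫ s in Set.Icc (t - d) t, stdGaussPdf s ≤ stdGaussCdf t :=
    setIntegral_mono_set integrable_stdGaussPdf.integrableOn
      (ae_of_all _ fun s => (stdGaussPdf_pos s).le) (Set.Icc_subset_Iic_self).eventuallyLE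
  have h3 : d * (Real.exp (-(3 / 2)) * stdGaussPdf t) ≤ stdGaussCdf t := by
    refine le_trans (le_of_eq ?_) (h1.trans h2)
    rw [setIntegral_const, Real.volume_real_Icc_of_le (by linarith), smul_eq_mul]
    ring
  have h4 : Real.exp (3 / 2) * Real.exp (-(3 / 2)) = 1 := by rw [← Real.exp_add]; simp
  calc stdGaussPdf t
    _ = Real.exp (3 / 2) * (1 + |t|) * (d * (Real.exp (-(3 / 2)) * stdGaussPdf t)) := by
        linear_combination (-stdGaussPdf t) * h4 -
          (Real.exp (3 / 2) * Real.exp (-(3 / 2)) * stdGaussPdf t) * hdt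
    _ ≤ _ := by gcongr

theorem stdGaussCdf_pos (t : ℝ) : 0 < stdGaussCdf t :=
  pos_of_mul_pos_right ((stdGaussPdf_pos t).trans_le (stdGaussPdf_le_mul_stdGaussCdf t))
    (by positivity)

theorem stdGaussCdf_add_neg (t : ℝ) : stdGaussCdf t + stdGaussCdf (-t) = 1 := by
  have h : stdGaussCdf (-t) = ∫ s in Set.Ioi t, stdGaussPdf s := by
    unfold stdGaussCdf
    rw [← integral_comp_neg_Ioi]
    simp [stdGaussPdf]
  rw [h, ← integral_stdGaussPdf, ← Set.compl_Iic]
  exact integral_add_compl measurableSet_Iic integrable_stdGaussPdf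

theorem stdGaussCdf_lt_one (t : ℝ) : stdGaussCdf t < 1 := by
  linarith [stdGaussCdf_add_neg t, stdGaussCdf_pos (-t)]

theorem stdGaussCdf_neg_le_exp {t : ℝ} (ht : 0 ≤ t) :
    stdGaussCdf (-t) ≤ Real.exp (-(t ^ 2) / 2) := by
  have hi : Integrable (fun s => Real.exp (-(t ^ 2) / 2) * stdGaussPdf (s + t)) :=
    (integrable_stdGaussPdf.comp_add_right t).const_mul _
  calc stdGaussCdf (-t)
      ≤ ∫ s in Set.Iic (-t), Real.exp (-(t ^ 2) / 2) * stdGaussPdf (s + t) := by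
        refine setIntegral_mono_on integrable_stdGaussPdf.integrableOn hi.integrableOn
          measurableSet_Iic fun s hs => ?_
        unfold stdGaussPdf
        rw [mul_left_comm, ← Real.exp_add]
        gcongr
        have : s + t ≤ 0 := by linarith [Set.mem_Iic.1 hs]
        nlinarith
    _ ≤ ∫ s, Real.exp (-(t ^ 2) / 2) * stdGaussPdf (s + t) :=
        setIntegral_le_integral hi
          (ae_of_all _ fun s => mul_nonneg (Real.exp_pos _).le (stdGaussPdf_pos _).le)
    _ = Real.exp (-(t ^ 2) / 2) := by
        rw [integral_const_mul, integral_add_right_eq_self, integral_stdGaussPdf, mul_one]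

/-- Weights controlling the growth of a function and of its first two derivatives. -/
structure GrowthWeights (X : Type*) where
  W : X → ℝ
  N₁ : X → ℝ
  N₂ : X → ℝ
  one_le_W : ∀ t, 1 ≤ W t
  one_le_N₁ : ∀ t, 1 ≤ N₁ t
  sq_le_N₂ : ∀ t, N₁ t * N₁ t ≤ N₂ t

/-- `H` is bounded on `S` by a constant times a power of `W` times `N`. -/
def PolyBdd {X : Type*} (S : Set X) (W N H : X → ℝ) : Prop :=
  ∃ C : ℝ, ∃ k : ℕ, 0 ≤ C ∧ ∀ t ∈ S, H t ≤ C * W t ^ k * N t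

namespace PolyBdd

variable {X : Type*} {S : Set X} {W N N' H H' : X → ℝ}

theorem of_le (h : PolyBdd S W N H) (hH : ∀ t ∈ S, H' t ≤ H t) : PolyBdd S W N H' := by
  obtain ⟨C, k, hC, hb⟩ := h
  exact ⟨C, k, hC, fun t ht => (hH t ht).trans (hb t ht)⟩

theorem weaken (h : PolyBdd S W N H) (hW : ∀ t, 1 ≤ W t) (hN : ∀ t ∈ S, N t ≤ N' t) :
    PolyBdd S W N' H := by
  obtain ⟨C, k, hC, hb⟩ := h
  refine ⟨C, k, hC, fun t ht => (hb t ht).trans ?_⟩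
  have := hW t
  gcongr
  exact hN t ht

theorem add (h : PolyBdd S W N H) (h' : PolyBdd S W N H') (hW : ∀ t, 1 ≤ W t)
    (hN : ∀ t, 0 ≤ N t) : PolyBdd S W N (fun t => H t + H' t) := by
  obtain ⟨C, k, hC, hb⟩ := h
  obtain ⟨C', k', hC', hb'⟩ := h'
  refine ⟨C + C', k + k', add_nonneg hC hC', fun t ht => ?_⟩
  have h1 : W t ^ k ≤ W t ^ (k + k') := pow_le_pow_right₀ (hW t) (by omega)
  have h2 : W t ^ k' ≤ W t ^ (k + k') := pow_le_pow_right₀ (hW t) (by omega)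
  have := hN t
  calc H t + H' t ≤ C * W t ^ k * N t + C' * W t ^ k' * N t := add_le_add (hb t ht) (hb' t ht)
    _ ≤ C * W t ^ (k + k') * N t + C' * W t ^ (k + k') * N t := by gcongr
    _ = _ := by ring

theorem mul (h : PolyBdd S W N H) (h' : PolyBdd S W N' H') (hH : ∀ t, 0 ≤ H t)
    (hH' : ∀ t, 0 ≤ H' t) : PolyBdd S W (fun t => N t * N' t) (fun t => H t * H' t) := by
  obtain ⟨C, k, hC, hb⟩ := h
  obtain ⟨C', k', hC', hb'⟩ := h'
  refine ⟨C * C', k + k', mul_nonneg hC hC', fun t ht => ?_⟩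
  calc H t * H' t ≤ (C * W t ^ k * N t) * (C' * W t ^ k' * N' t) :=
        mul_le_mul (hb t ht) (hb' t ht) (hH' t) ((hH t).trans (hb t ht))
    _ = _ := by rw [pow_add]; ring

end PolyBdd

/-- A family of twice differentiable functions on `U` which, together with its first two
derivatives, has polynomial growth on `K` relative to the weights `w`. -/
structure Tame {I P : Type*} [NormedAddCommGroup P] [NormedSpace ℝ P] (U K : Set P)
    (w : GrowthWeights (I × P)) (G : I → P → ℝ) : Prop where
  diff : ∀ i, ∀ θ ∈ U, DifferentiableAt ℝ (G i) θ
  diff_fderiv : ∀ i, ∀ θ ∈ U, DifferentiableAt ℝ (fderiv ℝ (G i)) θ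
  bdd : PolyBdd {t | t.2 ∈ K} w.W (fun _ => 1) (fun t => |G t.1 t.2|)
  bdd_fderiv : PolyBdd {t | t.2 ∈ K} w.W w.N₁ (fun t => ‖fderiv ℝ (G t.1) t.2‖)
  bdd_fderiv_fderiv :
    PolyBdd {t | t.2 ∈ K} w.W w.N₂ (fun t => ‖fderiv ℝ (fderiv ℝ (G t.1)) t.2‖)

namespace GrowthWeights

variable {X : Type*} (w : GrowthWeights X)

theorem N₁_nonneg (t : X) : 0 ≤ w.N₁ t := zero_le_one.trans (w.one_le_N₁ t)

theorem one_le_N₂ (t : X) : 1 ≤ w.N₂ t := by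
  nlinarith [w.one_le_N₁ t, w.sq_le_N₂ t]

theorem N₂_nonneg (t : X) : 0 ≤ w.N₂ t := zero_le_one.trans (w.one_le_N₂ t)

end GrowthWeights

namespace Tame

variable {I P : Type*} [NormedAddCommGroup P] [NormedSpace ℝ P] {U K : Set P}
  {w : GrowthWeights (I × P)} {G H : I → P → ℝ}

theorem of_contDiffOn (hU : IsOpen U) (hK : IsCompact K) (hKU : K ⊆ U) {A : P → ℝ}
    (hA : ContDiffOn ℝ 2 A U) : Tame U K w (fun _ : I => A) := by
  have h1 : ContDiffOn ℝ 1 (fderiv ℝ A) U := hA.fderiv_of_isOpen hU (by norm_num)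
  have h2 : ContDiffOn ℝ 0 (fderiv ℝ (fderiv ℝ A)) U := h1.fderiv_of_isOpen hU (by norm_num)
  have bound : ∀ {B : P → ℝ}, ContinuousOn B U → ∃ C : ℝ, 0 ≤ C ∧ ∀ θ ∈ K, B θ ≤ C := by
    intro B hB
    obtain ⟨C, hC⟩ := hK.exists_bound_of_continuousOn (hB.mono hKU)
    exact ⟨max C 0, le_max_right _ _,
      fun θ hθ => (le_abs_self _).trans ((hC θ hθ).trans (le_max_left _ _))⟩
  refine ⟨fun _ θ hθ => (hA.differentiableOn (by norm_num)).differentiableAt (hU.mem_nhds hθ),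
    fun _ θ hθ => (h1.differentiableOn (by norm_num)).differentiableAt (hU.mem_nhds hθ), ?_, ?_, ?_⟩
  · obtain ⟨C, hC, hb⟩ := bound hA.continuousOn.abs
    exact ⟨C, 0, hC, fun t ht => by simpa using hb t.2 ht⟩
  · obtain ⟨C, hC, hb⟩ := bound h1.continuousOn.norm
    refine ⟨C, 0, hC, fun t ht => ?_⟩
    simpa using (hb t.2 ht).trans (le_mul_of_one_le_right hC (w.one_le_N₁ t))
  · obtain ⟨C, hC, hb⟩ := bound
      ((continuous_norm (E := P →L[ℝ] P →L[ℝ] ℝ)).comp_continuousOn h2.continuousOn)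
    refine ⟨C, 0, hC, fun t ht => ?_⟩
    simpa using (hb t.2 ht).trans (le_mul_of_one_le_right hC (w.one_le_N₂ t))

theorem add (hU : IsOpen U) (hKU : K ⊆ U) (hG : Tame U K w G) (hH : Tame U K w H) :
    Tame U K w (fun i θ => G i θ + H i θ) := by
  have e : ∀ i, ∀ θ ∈ U,
      fderiv ℝ (fun θ => G i θ + H i θ) θ = fderiv ℝ (G i) θ + fderiv ℝ (H i) θ :=
    fun i θ hθ => fderiv_fun_add (hG.diff i θ hθ) (hH.diff i θ hθ)
  have ee : ∀ i, ∀ θ ∈ U, fderiv ℝ (fun θ => G i θ + H i θ) =ᶠ[nhds θ]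
      fun θ => fderiv ℝ (G i) θ + fderiv ℝ (H i) θ := fun i θ hθ => by
    filter_upwards [hU.mem_nhds hθ] with η hη using e i η hη
  refine ⟨fun i θ hθ => (hG.diff i θ hθ).add (hH.diff i θ hθ),
    fun i θ hθ => ((hG.diff_fderiv i θ hθ).add (hH.diff_fderiv i θ hθ)).congr_of_eventuallyEq
      (ee i θ hθ), (hG.bdd.add hH.bdd w.one_le_W (by simp)).of_le fun t _ => abs_add_le _ _,
    ?_, ?_⟩
  · refine (hG.bdd_fderiv.add hH.bdd_fderiv w.one_le_W w.N₁_nonneg).of_le fun t ht => ?_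
    rw [e t.1 t.2 (hKU ht)]
    exact norm_add_le _ _
  · refine (hG.bdd_fderiv_fderiv.add hH.bdd_fderiv_fderiv w.one_le_W w.N₂_nonneg).of_le
      fun t ht => ?_
    rw [(ee t.1 t.2 (hKU ht)).fderiv_eq, fderiv_fun_add (hG.diff_fderiv _ _ (hKU ht))
      (hH.diff_fderiv _ _ (hKU ht))]
    exact ContinuousLinearMap.opNorm_add_le _ _

theorem mul (hU : IsOpen U) (hKU : K ⊆ U) (hG : Tame U K w G) (hH : Tame U K w H) :
    Tame U K w (fun i θ => G i θ * H i θ) := by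
  have e : ∀ i, ∀ θ ∈ U, fderiv ℝ (fun θ => G i θ * H i θ) θ =
      G i θ • fderiv ℝ (H i) θ + H i θ • fderiv ℝ (G i) θ :=
    fun i θ hθ => fderiv_fun_mul (hG.diff i θ hθ) (hH.diff i θ hθ)
  have ee : ∀ i, ∀ θ ∈ U, fderiv ℝ (fun θ => G i θ * H i θ) =ᶠ[nhds θ]
      fun θ => G i θ • fderiv ℝ (H i) θ + H i θ • fderiv ℝ (G i) θ := fun i θ hθ => by
    filter_upwards [hU.mem_nhds hθ] with η hη using e i η hη
  have d : ∀ i, ∀ θ ∈ U, HasFDerivAt (fderiv ℝ (fun θ => G i θ * H i θ))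
      ((G i θ • fderiv ℝ (fderiv ℝ (H i)) θ + (fderiv ℝ (G i) θ).smulRight (fderiv ℝ (H i) θ)) +
        (H i θ • fderiv ℝ (fderiv ℝ (G i)) θ + (fderiv ℝ (H i) θ).smulRight (fderiv ℝ (G i) θ)))
      θ := fun i θ hθ =>
    (((hG.diff i θ hθ).hasFDerivAt.smul (hH.diff_fderiv i θ hθ).hasFDerivAt).add
      ((hH.diff i θ hθ).hasFDerivAt.smul
        (hG.diff_fderiv i θ hθ).hasFDerivAt)).congr_of_eventuallyEq (ee i θ hθ)
  refine ⟨fun i θ hθ => (hG.diff i θ hθ).mul (hH.diff i θ hθ),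
    fun i θ hθ => (d i θ hθ).differentiableAt, ?_, ?_, ?_⟩
  · exact ((hG.bdd.mul hH.bdd (by simp) (by simp)).weaken w.one_le_W (by simp)).of_le
      fun t _ => (abs_mul _ _).le
  · refine (((hG.bdd.mul hH.bdd_fderiv (by simp) (by simp)).add
      ((hH.bdd.mul hG.bdd_fderiv (by simp) (by simp))) w.one_le_W
        (by simpa using w.N₁_nonneg)).weaken w.one_le_W (by simp)).of_le fun t ht => ?_
    rw [e t.1 t.2 (hKU ht)]
    refine (norm_add_le _ _).trans ?_
    rw [norm_smul, norm_smul, Real.norm_eq_abs, Real.norm_eq_abs]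
  · have h₂ : ∀ {A B : I → P → ℝ}, Tame U K w A → Tame U K w B →
        PolyBdd {t : I × P | t.2 ∈ K} w.W w.N₂ (fun t => |A t.1 t.2| *
          ‖fderiv ℝ (fderiv ℝ (B t.1)) t.2‖ + ‖fderiv ℝ (A t.1) t.2‖ * ‖fderiv ℝ (B t.1) t.2‖) := by
      intro A B hA hB
      exact ((hA.bdd.mul hB.bdd_fderiv_fderiv (by simp)
        fun _ => ContinuousLinearMap.opNorm_nonneg _).weaken w.one_le_W
        (by simp)).add ((hA.bdd_fderiv.mul hB.bdd_fderiv (by simp) (by simp)).weaken w.one_le_W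
          fun t _ => w.sq_le_N₂ t) w.one_le_W w.N₂_nonneg
    refine ((h₂ hG hH).add (h₂ hH hG) w.one_le_W w.N₂_nonneg).of_le fun t ht => ?_
    rw [(d t.1 t.2 (hKU ht)).fderiv]
    refine (ContinuousLinearMap.opNorm_add_le _ _).trans (add_le_add ?_ ?_) <;>
    · refine (ContinuousLinearMap.opNorm_add_le _ _).trans_eq ?_
      rw [norm_smul, ContinuousLinearMap.norm_smulRight_apply, Real.norm_eq_abs]

end Tame

theorem pow_le_const_mul_exp {b : ℝ} (hb : 0 < b) (k : ℕ) {x : ℝ} (hx : 0 ≤ x) :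
    x ^ k ≤ k.factorial / b ^ k * Real.exp (b * x) := by
  have h := Real.pow_div_factorial_le_exp (b * x) (by positivity) k
  rw [div_le_iff₀ (by positivity), mul_pow] at h
  rw [div_mul_eq_mul_div, le_div_iff₀ (by positivity)]
  linarith

section ExpMulCdf

variable {P : Type*} [NormedAddCommGroup P] [NormedSpace ℝ P] {L Z : P → ℝ} {θ : P}

theorem hasFDerivAt_exp_mul_stdGaussCdf (hL : DifferentiableAt ℝ L θ)
    (hZ : DifferentiableAt ℝ Z θ) :
    HasFDerivAt (fun θ => Real.exp (L θ) * stdGaussCdf (Z θ))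
      ((Real.exp (L θ) * stdGaussCdf (Z θ)) • fderiv ℝ L θ +
        (Real.exp (L θ) * stdGaussPdf (Z θ)) • fderiv ℝ Z θ) θ := by
  refine (hL.hasFDerivAt.exp.mul
    ((hasDerivAt_stdGaussCdf _).comp_hasFDerivAt θ hZ.hasFDerivAt)).congr_fderiv ?_
  ext v
  simp
  ring

theorem hasFDerivAt_exp_mul_stdGaussPdf (hL : DifferentiableAt ℝ L θ)
    (hZ : DifferentiableAt ℝ Z θ) :
    HasFDerivAt (fun θ => Real.exp (L θ) * stdGaussPdf (Z θ))
      ((Real.exp (L θ) * stdGaussPdf (Z θ)) • fderiv ℝ L θ -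
        (Z θ * (Real.exp (L θ) * stdGaussPdf (Z θ))) • fderiv ℝ Z θ) θ := by
  refine (hL.hasFDerivAt.exp.mul
    ((hasDerivAt_stdGaussPdf _).comp_hasFDerivAt θ hZ.hasFDerivAt)).congr_fderiv ?_
  ext v
  simp
  ring

theorem norm_fderiv_fderiv_exp_mul_stdGaussCdf_le {U : Set P} (hU : IsOpen U) (hθ : θ ∈ U)
    (hL : ∀ θ ∈ U, DifferentiableAt ℝ L θ) (hZ : ∀ θ ∈ U, DifferentiableAt ℝ Z θ)
    (hL' : DifferentiableAt ℝ (fderiv ℝ L) θ) (hZ' : DifferentiableAt ℝ (fderiv ℝ Z) θ) {R : ℝ}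
    (hR : stdGaussPdf (Z θ) ≤ R * stdGaussCdf (Z θ)) :
    ‖fderiv ℝ (fderiv ℝ fun θ => Real.exp (L θ) * stdGaussCdf (Z θ)) θ‖ ≤
      Real.exp (L θ) * stdGaussCdf (Z θ) *
        ((‖fderiv ℝ (fderiv ℝ L) θ‖ + (‖fderiv ℝ L θ‖ + R * ‖fderiv ℝ Z θ‖) * ‖fderiv ℝ L θ‖) +
          (R * ‖fderiv ℝ (fderiv ℝ Z) θ‖ +
            (R * ‖fderiv ℝ L θ‖ + |Z θ| * R * ‖fderiv ℝ Z θ‖) * ‖fderiv ℝ Z θ‖)) := by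
  have e : fderiv ℝ (fun θ => Real.exp (L θ) * stdGaussCdf (Z θ)) =ᶠ[nhds θ] fun θ =>
      (Real.exp (L θ) * stdGaussCdf (Z θ)) • fderiv ℝ L θ +
        (Real.exp (L θ) * stdGaussPdf (Z θ)) • fderiv ℝ Z θ := by
    filter_upwards [hU.mem_nhds hθ] with η hη
    exact (hasFDerivAt_exp_mul_stdGaussCdf (hL η hη) (hZ η hη)).fderiv
  have d := ((hasFDerivAt_exp_mul_stdGaussCdf (hL θ hθ) (hZ θ hθ)).smul hL'.hasFDerivAt).add
    ((hasFDerivAt_exp_mul_stdGaussPdf (hL θ hθ) (hZ θ hθ)).smul hZ'.hasFDerivAt)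
  rw [(d.congr_of_eventuallyEq e).fderiv]
  have hE := Real.exp_pos (L θ)
  have hf : 0 < Real.exp (L θ) * stdGaussCdf (Z θ) := mul_pos hE (stdGaussCdf_pos _)
  have hp : 0 < Real.exp (L θ) * stdGaussPdf (Z θ) := mul_pos hE (stdGaussPdf_pos _)
  have hpf : Real.exp (L θ) * stdGaussPdf (Z θ) ≤ Real.exp (L θ) * stdGaussCdf (Z θ) * R := by
    calc _ ≤ Real.exp (L θ) * (R * stdGaussCdf (Z θ)) := by gcongr
      _ = _ := by ring
  generalize Real.exp (L θ) * stdGaussCdf (Z θ) = f at *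
  generalize Real.exp (L θ) * stdGaussPdf (Z θ) = r at *
  refine (ContinuousLinearMap.opNorm_add_le _ _).trans ?_
  rw [mul_add]
  refine add_le_add ((ContinuousLinearMap.opNorm_add_le _ _).trans ?_)
    ((ContinuousLinearMap.opNorm_add_le _ _).trans ?_)
  · rw [norm_smul, ContinuousLinearMap.norm_smulRight_apply, Real.norm_of_nonneg hf.le, mul_add,
      ← mul_assoc]
    gcongr
    refine (norm_add_le _ _).trans ?_
    rw [norm_smul, norm_smul, Real.norm_of_nonneg hf.le, Real.norm_of_nonneg hp.le, mul_add,
      ← mul_assoc]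
    gcongr
  · rw [norm_smul, ContinuousLinearMap.norm_smulRight_apply, Real.norm_of_nonneg hp.le, mul_add,
      ← mul_assoc, ← mul_assoc]
    gcongr
    refine (norm_sub_le _ _).trans ?_
    rw [norm_smul, norm_smul, Real.norm_of_nonneg hp.le, norm_mul, Real.norm_of_nonneg hp.le,
      Real.norm_eq_abs]
    calc r * ‖fderiv ℝ L θ‖ + |Z θ| * r * ‖fderiv ℝ Z θ‖
        ≤ f * R * ‖fderiv ℝ L θ‖ + |Z θ| * (f * R) * ‖fderiv ℝ Z θ‖ := by gcongr
      _ = _ := by ring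

end ExpMulCdf

theorem Tame.exists_rpow_mul_norm_fderiv_fderiv_le {I P : Type*} [NormedAddCommGroup P]
    [NormedSpace ℝ P] {U K : Set P} {w : GrowthWeights (I × P)} {f L Z : I → P → ℝ}
    (hU : IsOpen U) (hKU : K ⊆ U) (hL : Tame U K w L) (hZ : Tame U K w Z) {a c C₀ : ℝ}
    (ha : 0 < a) (hc : 0 < c) (hC₀ : 0 ≤ C₀)
    (hf : ∀ i, ∀ θ ∈ U, f i θ = Real.exp (L i θ) * stdGaussCdf (Z i θ))
    (hdecay : ∀ i, ∀ θ ∈ K, f i θ ≤ C₀ * Real.exp (-(c * w.W (i, θ)))) :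
    ∃ C : ℝ, 0 ≤ C ∧ ∀ i, ∀ θ ∈ K,
      f i θ ^ (a - 1) * ‖fderiv ℝ (fderiv ℝ (f i)) θ‖ ≤ C * w.N₂ (i, θ) := by
  set S : Set (I × P) := {t | t.2 ∈ K}
  let R : I × P → ℝ := fun t => Real.exp (3 / 2) * (1 + |Z t.1 t.2|)
  have hR0 : ∀ t, 0 ≤ R t := fun t => by positivity
  have hW := w.one_le_W
  have n1 : ∀ {G : I → P → ℝ} (t : I × P), 0 ≤ ‖fderiv ℝ (G t.1) t.2‖ := fun t => norm_nonneg _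
  have n2 : ∀ {G : I → P → ℝ} (t : I × P), 0 ≤ ‖fderiv ℝ (fderiv ℝ (G t.1)) t.2‖ :=
    fun t => ContinuousLinearMap.opNorm_nonneg _
  have hconst : ∀ b : ℝ, 0 ≤ b → PolyBdd S w.W (fun _ => 1) fun _ => b :=
    fun b hb => ⟨b, 0, hb, by simp⟩
  have hR : PolyBdd S w.W (fun _ => 1) R :=
    ((hconst _ (Real.exp_pos _).le).mul ((hconst 1 zero_le_one).add hZ.bdd hW (by simp))
      (fun _ => (Real.exp_pos _).le) (fun _ => by positivity)).weaken hW (by simp)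
  have hRZ : PolyBdd S w.W w.N₁ fun t => R t * ‖fderiv ℝ (Z t.1) t.2‖ :=
    (hR.mul hZ.bdd_fderiv hR0 n1).weaken hW (by simp)
  have hRL : PolyBdd S w.W w.N₁ fun t => R t * ‖fderiv ℝ (L t.1) t.2‖ :=
    (hR.mul hL.bdd_fderiv hR0 n1).weaken hW (by simp)
  have hZRZ : PolyBdd S w.W w.N₁ fun t => |Z t.1 t.2| * R t * ‖fderiv ℝ (Z t.1) t.2‖ :=
    (((hZ.bdd.mul hR (by simp) hR0).mul hZ.bdd_fderiv
      (fun t => mul_nonneg (abs_nonneg _) (hR0 t)) n1)).weaken hW (by simp)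
  have q1 := (hL.bdd_fderiv.add hRZ hW w.N₁_nonneg).mul hL.bdd_fderiv
    (fun t => add_nonneg (n1 t) (mul_nonneg (hR0 t) (n1 t))) n1
  have q2 := (hRL.add hZRZ hW w.N₁_nonneg).mul hZ.bdd_fderiv
    (fun t => add_nonneg (mul_nonneg (hR0 t) (n1 t))
      (mul_nonneg (mul_nonneg (abs_nonneg _) (hR0 t)) (n1 t))) n1
  have q3 : PolyBdd S w.W w.N₂ fun t => R t * ‖fderiv ℝ (fderiv ℝ (Z t.1)) t.2‖ :=
    (hR.mul hZ.bdd_fderiv_fderiv hR0 n2).weaken hW (by simp)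
  obtain ⟨C, k, hC, hb⟩ := (hL.bdd_fderiv_fderiv.add (q1.weaken hW fun t _ => w.sq_le_N₂ t) hW
    w.N₂_nonneg).add (q3.add (q2.weaken hW fun t _ => w.sq_le_N₂ t) hW w.N₂_nonneg) hW w.N₂_nonneg
  refine ⟨C₀ ^ a * C * (k.factorial / (a * c) ^ k), by positivity, fun i θ hθ => ?_⟩
  have e : f i =ᶠ[nhds θ] fun θ => Real.exp (L i θ) * stdGaussCdf (Z i θ) := by
    filter_upwards [hU.mem_nhds (hKU hθ)] with η hη using hf i η hη
  have h1 := norm_fderiv_fderiv_exp_mul_stdGaussCdf_le hU (hKU hθ) (hL.diff i) (hZ.diff i)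
    (hL.diff_fderiv i θ (hKU hθ)) (hZ.diff_fderiv i θ (hKU hθ))
    (stdGaussPdf_le_mul_stdGaussCdf (Z i θ))
  have hf0 : 0 < f i θ := by
    rw [hf i θ (hKU hθ)]
    exact mul_pos (Real.exp_pos _) (stdGaussCdf_pos _)
  rw [← e.fderiv.fderiv_eq, ← hf i θ (hKU hθ)] at h1
  have h2 := h1.trans (mul_le_mul_of_nonneg_left (hb (i, θ) hθ) hf0.le)
  have h3 := hdecay i θ hθ
  have h4 : f i θ ^ a ≤ C₀ ^ a * Real.exp (-(a * c * w.W (i, θ))) := by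
    refine (Real.rpow_le_rpow hf0.le h3 ha.le).trans_eq ?_
    rw [Real.mul_rpow hC₀ (Real.exp_pos _).le, ← Real.exp_mul]
    ring_nf
  have hW0 : 0 ≤ w.W (i, θ) := zero_le_one.trans (hW _)
  have hN := w.N₂_nonneg (i, θ)
  have h5 := pow_le_const_mul_exp (mul_pos ha hc) k hW0
  have h6 : Real.exp (-(a * c * w.W (i, θ))) * Real.exp (a * c * w.W (i, θ)) = 1 := by
    rw [← Real.exp_add]; simp
  calc f i θ ^ (a - 1) * _
    _ ≤ f i θ ^ (a - 1) * (f i θ * (C * w.W (i, θ) ^ k * w.N₂ (i, θ))) := by gcongr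
    _ = f i θ ^ a * (C * w.W (i, θ) ^ k * w.N₂ (i, θ)) := by
      rw [← mul_assoc, Real.rpow_sub_one hf0.ne', div_mul_cancel₀ _ hf0.ne']
    _ ≤ (C₀ ^ a * Real.exp (-(a * c * w.W (i, θ)))) *
        (C * (k.factorial / (a * c) ^ k * Real.exp (a * c * w.W (i, θ))) * w.N₂ (i, θ)) := by
      gcongr
    _ = C₀ ^ a * C * (k.factorial / (a * c) ^ k) * w.N₂ (i, θ) *
        (Real.exp (-(a * c * w.W (i, θ))) * Real.exp (a * c * w.W (i, θ))) := by ring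
    _ = _ := by rw [h6, mul_one]

section Frontier

variable {p q : ℕ} {E : Type*} [NormedAddCommGroup E] [NormedSpace ℝ E]

/-- The growth weights attached to the residual `y - g x β`. -/
noncomputable def residualWeights (E : Type*) (g : (Fin p → ℝ) → (Fin q → ℝ) → ℝ) :
    GrowthWeights (((Fin p → ℝ) × ℝ) × ((Fin q → ℝ) × E)) where
  W t := 1 + |t.1.2 - g t.1.1 t.2.1|
  N₁ t := 1 + ‖fderiv ℝ (g t.1.1) t.2.1‖
  N₂ t := (1 + ‖fderiv ℝ (g t.1.1) t.2.1‖) ^ 2 + ‖fderiv ℝ (fderiv ℝ (g t.1.1)) t.2.1‖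
  one_le_W t := by simp
  one_le_N₁ t := by simp
  sq_le_N₂ t := by
    rw [← sq]
    exact le_add_of_nonneg_right (ContinuousLinearMap.opNorm_nonneg _)

theorem tame_residual {g : (Fin p → ℝ) → (Fin q → ℝ) → ℝ} (hg1 : ∀ x, Differentiable ℝ (g x))
    (hg2 : ∀ x, Differentiable ℝ (fderiv ℝ (g x))) (U K : Set ((Fin q → ℝ) × E)) :
    Tame U K (residualWeights E g) (fun i θ => i.2 - g i.1 θ.1) := by
  have d1 : ∀ (i : (Fin p → ℝ) × ℝ) (θ : (Fin q → ℝ) × E),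
      HasFDerivAt (fun θ : (Fin q → ℝ) × E => i.2 - g i.1 θ.1)
        (-(fderiv ℝ (g i.1) θ.1).comp (ContinuousLinearMap.fst ℝ (Fin q → ℝ) E)) θ := fun i θ =>
    ((hg1 i.1 θ.1).hasFDerivAt.comp θ hasFDerivAt_fst).const_sub _
  have e1 : ∀ i : (Fin p → ℝ) × ℝ, fderiv ℝ (fun θ : (Fin q → ℝ) × E => i.2 - g i.1 θ.1) =
      fun θ => -(fderiv ℝ (g i.1) θ.1).comp (ContinuousLinearMap.fst ℝ (Fin q → ℝ) E) :=
    fun i => funext fun θ => (d1 i θ).fderiv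
  let Q : ((Fin q → ℝ) →L[ℝ] ℝ) →L[ℝ] (((Fin q → ℝ) × E) →L[ℝ] ℝ) :=
    (ContinuousLinearMap.compL ℝ ((Fin q → ℝ) × E) (Fin q → ℝ) ℝ).flip
      (ContinuousLinearMap.fst ℝ (Fin q → ℝ) E)
  have d2 : ∀ (i : (Fin p → ℝ) × ℝ) (θ : (Fin q → ℝ) × E),
      HasFDerivAt (fderiv ℝ (fun θ : (Fin q → ℝ) × E => i.2 - g i.1 θ.1))
        (-(Q.comp ((fderiv ℝ (fderiv ℝ (g i.1)) θ.1).comp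
          (ContinuousLinearMap.fst ℝ (Fin q → ℝ) E)))) θ := by
    intro i θ
    rw [e1]
    exact (Q.hasFDerivAt.comp θ ((hg2 i.1 θ.1).hasFDerivAt.comp θ hasFDerivAt_fst)).neg
  have hfst : ‖ContinuousLinearMap.fst ℝ (Fin q → ℝ) E‖ ≤ 1 := ContinuousLinearMap.norm_fst_le ..
  refine ⟨fun i θ _ => (d1 i θ).differentiableAt, fun i θ _ => (d2 i θ).differentiableAt,
    ⟨1, 1, zero_le_one, fun t _ => ?_⟩, ⟨1, 0, zero_le_one, fun t _ => ?_⟩,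
    ⟨1, 0, zero_le_one, fun t _ => ?_⟩⟩
  · simp [residualWeights]
  · dsimp only
    rw [(d1 t.1 t.2).fderiv, norm_neg]
    refine (ContinuousLinearMap.opNorm_comp_le _ _).trans ?_
    refine (mul_le_of_le_one_right (norm_nonneg _) hfst).trans ?_
    simp [residualWeights]
  · dsimp only
    rw [(d2 t.1 t.2).fderiv, ContinuousLinearMap.opNorm_neg]
    have hQ : ‖Q‖ ≤ 1 := by
      refine ContinuousLinearMap.opNorm_le_bound _ zero_le_one fun A => ?_
      rw [one_mul]
      exact (ContinuousLinearMap.opNorm_comp_le _ _).trans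
        (mul_le_of_le_one_right (norm_nonneg _) hfst)
    have h0 := ContinuousLinearMap.opNorm_nonneg (fderiv ℝ (fderiv ℝ (g t.1.1)) t.2.1)
    refine (ContinuousLinearMap.opNorm_comp_le _ _).trans ?_
    refine (mul_le_of_le_one_left (ContinuousLinearMap.opNorm_nonneg _) hQ).trans ?_
    refine (ContinuousLinearMap.opNorm_comp_le _ _).trans ?_
    refine (mul_le_of_le_one_right h0 hfst).trans ?_
    simp [residualWeights]
    positivity

/-- `Tame.exists_rpow_mul_norm_fderiv_fderiv_le` for the weights attached to the residual. -/
theorem exists_rpow_mul_norm_fderiv_fderiv_le_of_tame_residual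
    {g : (Fin p → ℝ) → (Fin q → ℝ) → ℝ} {U K : Set ((Fin q → ℝ) × E)}
    (hU : IsOpen U) (hKU : K ⊆ U) {f L Z : (Fin p → ℝ) × ℝ → (Fin q → ℝ) × E → ℝ}
    (hL : Tame U K (residualWeights E g) L) (hZ : Tame U K (residualWeights E g) Z)
    {a c C₀ : ℝ} (ha : 0 < a) (hc : 0 < c) (hC₀ : 0 ≤ C₀)
    (hf : ∀ i, ∀ θ ∈ U, f i θ = Real.exp (L i θ) * stdGaussCdf (Z i θ))
    (hdecay : ∀ i, ∀ θ ∈ K, f i θ ≤ C₀ * Real.exp (-(c * (1 + |i.2 - g i.1 θ.1|)))) :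
    ∃ C : ℝ, 0 ≤ C ∧ ∀ i, ∀ θ ∈ K,
      f i θ ^ (a - 1) * ‖fderiv ℝ (fderiv ℝ (f i)) θ‖ ≤ C * (residualWeights E g).N₂ (i, θ) :=
  Tame.exists_rpow_mul_norm_fderiv_fderiv_le hU hKU hL hZ ha hc hC₀ hf hdecay

theorem residualWeights_N₂_le {E : Type*} (g : (Fin p → ℝ) → (Fin q → ℝ) → ℝ)
    (t : ((Fin p → ℝ) × ℝ) × ((Fin q → ℝ) × E)) :
    (residualWeights E g).N₂ t ≤ 2 * (1 + ‖fderiv ℝ (g t.1.1) t.2.1‖ ^ 2 +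
      ‖fderiv ℝ (fderiv ℝ (g t.1.1)) t.2.1‖) := by
  have h0 := ContinuousLinearMap.opNorm_nonneg (fderiv ℝ (fderiv ℝ (g t.1.1)) t.2.1)
  simp only [residualWeights]
  nlinarith [sq_nonneg (1 - ‖fderiv ℝ (g t.1.1) t.2.1‖)]

theorem exists_ennreal_bound_of_residualWeights {E : Type*} {g : (Fin p → ℝ) → (Fin q → ℝ) → ℝ}
    {B : Set (Fin q → ℝ)} {K : Set ((Fin q → ℝ) × E)} (hKB : ∀ θ ∈ K, θ.1 ∈ B)
    {H : (Fin p → ℝ) → ℝ → ((Fin q → ℝ) × E) → ℝ}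
    (h : ∃ C : ℝ, 0 ≤ C ∧ ∀ i : (Fin p → ℝ) × ℝ, ∀ θ ∈ K,
      H i.1 i.2 θ ≤ C * (residualWeights E g).N₂ (i, θ)) :
    ∃ C : ℝ≥0∞, C ≠ ⊤ ∧ ∀ θ ∈ K, ∀ (x : Fin p → ℝ) (y : ℝ), ENNReal.ofReal (H x y θ) ≤
      C * (1 + (⨆ β ∈ B, ENNReal.ofReal (‖fderiv ℝ (g x) β‖ ^ 2)) +
        ⨆ β ∈ B, ENNReal.ofReal ‖fderiv ℝ (fderiv ℝ (g x)) β‖) := by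
  obtain ⟨C, hC, hb⟩ := h
  refine ⟨ENNReal.ofReal (C * 2), ENNReal.ofReal_ne_top, fun θ hθ x y => ?_⟩
  have h0 := ContinuousLinearMap.opNorm_nonneg (fderiv ℝ (fderiv ℝ (g x)) θ.1)
  have h1 : H x y θ ≤ C * 2 * (1 + ‖fderiv ℝ (g x) θ.1‖ ^ 2 + ‖fderiv ℝ (fderiv ℝ (g x)) θ.1‖) := by
    rw [mul_assoc]
    exact (hb (x, y) θ hθ).trans
      (mul_le_mul_of_nonneg_left (residualWeights_N₂_le g ((x, y), θ)) hC)
  refine (ENNReal.ofReal_le_ofReal h1).trans ?_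
  rw [ENNReal.ofReal_mul (by positivity), ENNReal.ofReal_add (by positivity) h0,
    ENNReal.ofReal_add zero_le_one (by positivity), ENNReal.ofReal_one]
  gcongr
  · exact le_iSup₂ (f := fun β _ => ENNReal.ofReal (‖fderiv ℝ (g x) β‖ ^ 2)) θ.1 (hKB θ hθ)
  · exact le_iSup₂ (f := fun β _ => ENNReal.ofReal ‖fderiv ℝ (fderiv ℝ (g x)) β‖) θ.1 (hKB θ hθ)

end Frontier

/-- The logarithm of the prefactor of the normal–truncated-normal density. -/
noncomputable def logPrefactorNT {q : ℕ} (θ : (Fin q → ℝ) × ℝ × ℝ × ℝ) : ℝ :=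
  Real.log ((Real.sqrt (θ.2.2.1 ^ 2 + θ.2.2.2 ^ 2))⁻¹ *
    (1 - stdGaussCdf (-(θ.2.1 / θ.2.2.2)))⁻¹ * (Real.sqrt (2 * Real.pi))⁻¹)

theorem fNT_eq_exp_mul {p q : ℕ} (g : (Fin p → ℝ) → (Fin q → ℝ) → ℝ)
    {θ : (Fin q → ℝ) × ℝ × ℝ × ℝ} (hv : 0 < θ.2.2.1) (hu : 0 < θ.2.2.2) (x : Fin p → ℝ) (y : ℝ) :
    fNT g θ x y =
      Real.exp (logPrefactorNT θ + (y - g x θ.1 + θ.2.1) * ((y - g x θ.1 + θ.2.1) *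
        -(2 * (θ.2.2.1 ^ 2 + θ.2.2.2 ^ 2))⁻¹)) *
      stdGaussCdf (θ.2.1 / (Real.sqrt (θ.2.2.1 ^ 2 + θ.2.2.2 ^ 2) * (θ.2.2.2 / θ.2.2.1)) +
        (y - g x θ.1) *
          -((θ.2.2.2 / θ.2.2.1) / Real.sqrt (θ.2.2.1 ^ 2 + θ.2.2.2 ^ 2))) := by
  have hs : 0 < θ.2.2.1 ^ 2 + θ.2.2.2 ^ 2 := by positivity
  have hs' : 0 < Real.sqrt (θ.2.2.1 ^ 2 + θ.2.2.2 ^ 2) := Real.sqrt_pos.2 hs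
  have h1 := sub_pos.2 (stdGaussCdf_lt_one (-(θ.2.1 / θ.2.2.2)))
  rw [Real.exp_add, logPrefactorNT, Real.exp_log (by positivity)]
  simp only [fNT]
  rw [stdGaussPdf, div_pow, Real.sq_sqrt hs.le, ← mul_assoc]
  congr 2
  · congr 1
    field_simp
  · ring

theorem density_hessian_bound_fNT {p q : ℕ} (g : (Fin p → ℝ) → (Fin q → ℝ) → ℝ)
    (hg1 : ∀ x, Differentiable ℝ (g x)) (hg2 : ∀ x, Differentiable ℝ (fderiv ℝ (g x)))
    {a : ℝ} (ha : 0 < a) (bl bu ul uu : ℝ) {sl su : ℝ} (hsl : 0 < sl) (hs : sl ≤ su) :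
    ∃ C : ℝ, 0 ≤ C ∧ ∀ i : (Fin p → ℝ) × ℝ, ∀ θ ∈ boxNT q bl bu ul uu sl su,
      fNT g θ i.1 i.2 ^ (a - 1) * ‖fderiv ℝ (fderiv ℝ (fun t => fNT g t i.1 i.2)) θ‖ ≤
        C * (residualWeights (ℝ × ℝ × ℝ) g).N₂ (i, θ) := by
  let U : Set ((Fin q → ℝ) × ℝ × ℝ × ℝ) := {θ | 0 < θ.2.2.1 ∧ 0 < θ.2.2.2}
  let K := boxNT q bl bu ul uu sl su
  have hU : IsOpen U := by
    have h1 : Continuous fun θ : (Fin q → ℝ) × ℝ × ℝ × ℝ => θ.2.2.1 := by fun_prop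
    have h2 : Continuous fun θ : (Fin q → ℝ) × ℝ × ℝ × ℝ => θ.2.2.2 := by fun_prop
    exact (isOpen_lt continuous_const h1).inter (isOpen_lt continuous_const h2)
  have hK : IsCompact K :=
    isCompact_Icc.prod (isCompact_Icc.prod (isCompact_Icc.prod isCompact_Icc))
  have hKU : K ⊆ U := fun θ hθ => ⟨hsl.trans_le hθ.2.2.1.1, hsl.trans_le hθ.2.2.2.1⟩
  have tame : ∀ {A : (Fin q → ℝ) × ℝ × ℝ × ℝ → ℝ}, (∀ θ ∈ U, ContDiffAt ℝ 2 A θ) →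
      Tame U K (residualWeights (p := p) (ℝ × ℝ × ℝ) g) (fun _ => A) := fun hA =>
    Tame.of_contDiffOn hU hK hKU fun θ hθ => (hA θ hθ).contDiffWithinAt
  have hsq : ∀ θ ∈ U, 0 < θ.2.2.1 ^ 2 + θ.2.2.2 ^ 2 := fun θ hθ =>
    add_pos (pow_pos hθ.1 2) (pow_pos hθ.2 2)
  have cv : ∀ θ ∈ U, ContDiffAt ℝ 2 (fun θ : (Fin q → ℝ) × ℝ × ℝ × ℝ => θ.2.2.1) θ :=
    fun θ _ => by fun_prop
  have cu : ∀ θ ∈ U, ContDiffAt ℝ 2 (fun θ : (Fin q → ℝ) × ℝ × ℝ × ℝ => θ.2.2.2) θ :=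
    fun θ _ => by fun_prop
  have cμ : ∀ θ ∈ U, ContDiffAt ℝ 2 (fun θ : (Fin q → ℝ) × ℝ × ℝ × ℝ => θ.2.1) θ :=
    fun θ _ => by fun_prop
  have cs2 : ∀ θ ∈ U, ContDiffAt ℝ 2
      (fun θ : (Fin q → ℝ) × ℝ × ℝ × ℝ => θ.2.2.1 ^ 2 + θ.2.2.2 ^ 2) θ := fun θ _ => by fun_prop
  have cs : ∀ θ ∈ U, ContDiffAt ℝ 2
      (fun θ : (Fin q → ℝ) × ℝ × ℝ × ℝ => Real.sqrt (θ.2.2.1 ^ 2 + θ.2.2.2 ^ 2)) θ :=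
    fun θ hθ => (cs2 θ hθ).sqrt (hsq θ hθ).ne'
  have clam : ∀ θ ∈ U, ContDiffAt ℝ 2
      (fun θ : (Fin q → ℝ) × ℝ × ℝ × ℝ => θ.2.2.2 / θ.2.2.1) θ :=
    fun θ hθ => (cu θ hθ).div (cv θ hθ) hθ.1.ne'
  have hs0 : ∀ θ ∈ U, 0 < Real.sqrt (θ.2.2.1 ^ 2 + θ.2.2.2 ^ 2) := fun θ hθ =>
    Real.sqrt_pos.2 (hsq θ hθ)
  have hcdf : ∀ t, 0 < 1 - stdGaussCdf t := fun t => sub_pos.2 (stdGaussCdf_lt_one t)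
  have hpi : 0 < (Real.sqrt (2 * Real.pi))⁻¹ := by positivity
  have cA : ∀ θ ∈ U, ContDiffAt ℝ 2 (logPrefactorNT (q := q)) θ := fun θ hθ =>
    ((((cs θ hθ).inv (hs0 θ hθ).ne').mul ((contDiffAt_const.sub
      (contDiff_stdGaussCdf.contDiffAt.comp θ ((cμ θ hθ).div (cu θ hθ) hθ.2.ne').neg)).inv
        (hcdf _).ne')).mul contDiffAt_const).log
      (mul_pos (mul_pos (inv_pos.2 (hs0 θ hθ)) (inv_pos.2 (hcdf _))) hpi).ne'
  have tA := tame cA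
  have tr := tame_residual hg1 hg2 U K
  have trμ := tr.add hU hKU (tame cμ)
  have tB := tame (A := fun θ => -(2 * (θ.2.2.1 ^ 2 + θ.2.2.2 ^ 2))⁻¹) fun θ hθ =>
    ((contDiffAt_const.mul (cs2 θ hθ)).inv (mul_pos two_pos (hsq θ hθ)).ne').neg
  have tL := tA.add hU hKU (trμ.mul hU hKU (trμ.mul hU hKU tB))
  have tC := tame (A := fun θ =>
      θ.2.1 / (Real.sqrt (θ.2.2.1 ^ 2 + θ.2.2.2 ^ 2) * (θ.2.2.2 / θ.2.2.1))) fun θ hθ =>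
    (cμ θ hθ).div ((cs θ hθ).mul (clam θ hθ)) (mul_pos (hs0 θ hθ) (div_pos hθ.2 hθ.1)).ne'
  have tD := tame (A := fun θ =>
      -((θ.2.2.2 / θ.2.2.1) / Real.sqrt (θ.2.2.1 ^ 2 + θ.2.2.2 ^ 2))) fun θ hθ =>
    ((clam θ hθ).div (cs θ hθ) (hs0 θ hθ).ne').neg
  have tZ := tC.add hU hKU (tr.mul hU hKU tD)
  obtain ⟨MA, hMA⟩ := hK.exists_bound_of_continuousOn
    (fun θ hθ => (cA θ (hKU hθ)).continuousAt.continuousWithinAt)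
  have hsu : 0 < su := hsl.trans_le hs
  set M := max |ul| |uu|
  have hdecay : ∀ i : (Fin p → ℝ) × ℝ, ∀ θ ∈ K, fNT g θ i.1 i.2 ≤
      Real.exp (MA + (2 * M + 3) / (4 * su ^ 2)) *
        Real.exp (-((2 * su ^ 2)⁻¹ * (1 + |i.2 - g i.1 θ.1|))) := by
    intro i θ hθ
    have hθU := hKU hθ
    rw [fNT_eq_exp_mul g hθU.1 hθU.2]
    refine (mul_le_of_le_one_right (Real.exp_pos _).le (stdGaussCdf_lt_one _).le).trans ?_
    rw [← Real.exp_add, Real.exp_le_exp]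
    have h1 : logPrefactorNT θ ≤ MA := (le_abs_self _).trans (hMA θ hθ)
    have h2 : |θ.2.1| ≤ M := abs_le_max_abs_abs hθ.2.1.1 hθ.2.1.2
    have h3 : 2 * (θ.2.2.1 ^ 2 + θ.2.2.2 ^ 2) ≤ 4 * su ^ 2 := by
      have := pow_le_pow_left₀ hθU.1.le hθ.2.2.1.2 2
      have := pow_le_pow_left₀ hθU.2.le hθ.2.2.2.2 2
      linarith
    have h4 : (4 * su ^ 2)⁻¹ ≤ (2 * (θ.2.2.1 ^ 2 + θ.2.2.2 ^ 2))⁻¹ :=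
      inv_anti₀ (mul_pos two_pos (hsq θ hθU)) h3
    generalize i.2 - g i.1 θ.1 = r
    have h5 : 2 * |r| - 2 * M - 1 ≤ (r + θ.2.1) ^ 2 := by
      have h6 : |r| ≤ |r + θ.2.1| + |θ.2.1| := by
        simpa using abs_sub (r + θ.2.1) θ.2.1
      have h7 := sq_nonneg (|r + θ.2.1| - 1)
      rw [← sq_abs (r + θ.2.1)]
      linarith
    have h8 := mul_le_mul_of_nonneg_left h4 (sq_nonneg (r + θ.2.1))
    have h9 := mul_le_mul_of_nonneg_right h5 (by positivity : 0 ≤ (4 * su ^ 2)⁻¹)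
    have h10 : (2 * su ^ 2)⁻¹ = 2 * (4 * su ^ 2)⁻¹ := by field_simp; norm_num
    rw [h10, div_eq_mul_inv]
    linarith
  exact exists_rpow_mul_norm_fderiv_fderiv_le_of_tame_residual
    (f := fun i θ => fNT g θ i.1 i.2) hU hKU tL tZ ha (by positivity) (Real.exp_pos _).le
    (fun i θ hθ => fNT_eq_exp_mul g hθ.1 hθ.2 i.1 i.2) hdecay

theorem fNE_eq_exp_mul {p q : ℕ} (g : (Fin p → ℝ) → (Fin q → ℝ) → ℝ)
    {θ : (Fin q → ℝ) × ℝ × ℝ} (hu : 0 < θ.2.2) (x : Fin p → ℝ) (y : ℝ) :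
    fNE g θ x y =
      Real.exp ((θ.2.1 ^ 2 / (2 * θ.2.2 ^ 2) - Real.log θ.2.2) + (y - g x θ.1) * θ.2.2⁻¹) *
      stdGaussCdf (-(θ.2.1 / θ.2.2) + (y - g x θ.1) * -(θ.2.1)⁻¹) := by
  rw [Real.exp_add, Real.exp_sub, Real.exp_log hu]
  simp only [fNE]
  rw [Real.exp_add, div_eq_mul_inv (y - g x θ.1), div_eq_mul_inv (y - g x θ.1)]
  ring_nf

theorem fNE_le_exp {p q : ℕ} (g : (Fin p → ℝ) → (Fin q → ℝ) → ℝ) {θ : (Fin q → ℝ) × ℝ × ℝ}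
    {sl su : ℝ} (hsl : 0 < sl) (hv : θ.2.1 ∈ Set.Icc sl su) (hu : θ.2.2 ∈ Set.Icc sl su)
    (x : Fin p → ℝ) (y : ℝ) :
    fNE g θ x y ≤ sl⁻¹ * Real.exp (su ^ 2 / (2 * sl ^ 2) + 1 / 2 + su⁻¹) *
      Real.exp (-(su⁻¹ * (1 + |y - g x θ.1|))) := by
  have hv0 : 0 < θ.2.1 := hsl.trans_le hv.1
  have hu0 : 0 < θ.2.2 := hsl.trans_le hu.1
  have hsu : 0 < su := hv0.trans_le hv.2
  simp only [fNE]
  generalize y - g x θ.1 = r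
  have h1 : θ.2.2⁻¹ ≤ sl⁻¹ := inv_anti₀ hsl hu.1
  rw [mul_assoc, mul_assoc]
  refine mul_le_mul h1 ?_ (mul_nonneg (stdGaussCdf_pos _).le (Real.exp_pos _).le) (by positivity)
  rw [← Real.exp_add]
  have h2 : su⁻¹ ≤ θ.2.2⁻¹ := inv_anti₀ hu0 hu.2
  have h2' : su⁻¹ ≤ θ.2.1⁻¹ := inv_anti₀ hv0 hv.2
  have h3 : θ.2.1 ^ 2 / (2 * θ.2.2 ^ 2) ≤ su ^ 2 / (2 * sl ^ 2) := by
    have := hv.2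
    have := hu.1
    gcongr
  rcases le_total 0 r with hr | hr
  · have h4 : 0 ≤ r / θ.2.1 + θ.2.1 / θ.2.2 := by positivity
    have h5 := stdGaussCdf_neg_le_exp h4
    rw [neg_add, ← sub_eq_add_neg] at h5
    refine (mul_le_mul_of_nonneg_right h5 (Real.exp_pos _).le).trans ?_
    rw [← Real.exp_add, Real.exp_le_exp, abs_of_nonneg hr]
    have h6 : -(r / θ.2.1 + θ.2.1 / θ.2.2) ^ 2 / 2 + (r / θ.2.2 + θ.2.1 ^ 2 / (2 * θ.2.2 ^ 2)) =
        -(r * θ.2.1⁻¹) ^ 2 / 2 := by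
      field_simp
      ring
    rw [h6]
    have h7 : su⁻¹ * r ≤ r * θ.2.1⁻¹ := by nlinarith
    have h8 : 0 ≤ su ^ 2 / (2 * sl ^ 2) := by positivity
    nlinarith [sq_nonneg (r * θ.2.1⁻¹ - 1)]
  · refine (mul_le_of_le_one_left (Real.exp_pos _).le (stdGaussCdf_lt_one _).le).trans ?_
    rw [Real.exp_le_exp, abs_of_nonpos hr, div_eq_mul_inv r]
    nlinarith

theorem density_hessian_bound_fNE {p q : ℕ} (g : (Fin p → ℝ) → (Fin q → ℝ) → ℝ)
    (hg1 : ∀ x, Differentiable ℝ (g x)) (hg2 : ∀ x, Differentiable ℝ (fderiv ℝ (g x)))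
    {a : ℝ} (ha : 0 < a) (bl bu : ℝ) {sl su : ℝ} (hsl : 0 < sl) (hs : sl ≤ su) :
    ∃ C : ℝ, 0 ≤ C ∧ ∀ i : (Fin p → ℝ) × ℝ, ∀ θ ∈ boxNE q bl bu sl su,
      fNE g θ i.1 i.2 ^ (a - 1) * ‖fderiv ℝ (fderiv ℝ (fun t => fNE g t i.1 i.2)) θ‖ ≤
        C * (residualWeights (ℝ × ℝ) g).N₂ (i, θ) := by
  let U : Set ((Fin q → ℝ) × ℝ × ℝ) := {θ | 0 < θ.2.1 ∧ 0 < θ.2.2}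
  let K := boxNE q bl bu sl su
  have hU : IsOpen U := by
    have h1 : Continuous fun θ : (Fin q → ℝ) × ℝ × ℝ => θ.2.1 := by fun_prop
    have h2 : Continuous fun θ : (Fin q → ℝ) × ℝ × ℝ => θ.2.2 := by fun_prop
    exact (isOpen_lt continuous_const h1).inter (isOpen_lt continuous_const h2)
  have hK : IsCompact K := isCompact_Icc.prod (isCompact_Icc.prod isCompact_Icc)
  have hKU : K ⊆ U := fun θ hθ => ⟨hsl.trans_le hθ.2.1.1, hsl.trans_le hθ.2.2.1⟩
  have hsu : 0 < su := hsl.trans_le hs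
  have tame : ∀ {A : (Fin q → ℝ) × ℝ × ℝ → ℝ}, (∀ θ ∈ U, ContDiffAt ℝ 2 A θ) →
      Tame U K (residualWeights (p := p) (ℝ × ℝ) g) (fun _ => A) := fun hA =>
    Tame.of_contDiffOn hU hK hKU fun θ hθ => (hA θ hθ).contDiffWithinAt
  have cv : ∀ θ ∈ U, ContDiffAt ℝ 2 (fun θ : (Fin q → ℝ) × ℝ × ℝ => θ.2.1) θ :=
    fun θ _ => by fun_prop
  have cu : ∀ θ ∈ U, ContDiffAt ℝ 2 (fun θ : (Fin q → ℝ) × ℝ × ℝ => θ.2.2) θ :=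
    fun θ _ => by fun_prop
  have tr := tame_residual hg1 hg2 U K
  have tA := tame (A := fun θ => θ.2.1 ^ 2 / (2 * θ.2.2 ^ 2) - Real.log θ.2.2) fun θ hθ =>
    (((cv θ hθ).pow 2).div (contDiffAt_const.mul ((cu θ hθ).pow 2))
      (mul_pos two_pos (pow_pos hθ.2 2)).ne').sub ((cu θ hθ).log hθ.2.ne')
  have tB := tame (A := fun θ => θ.2.2⁻¹) fun θ hθ => (cu θ hθ).inv hθ.2.ne'
  have tC := tame (A := fun θ => -(θ.2.1 / θ.2.2)) fun θ hθ =>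
    ((cv θ hθ).div (cu θ hθ) hθ.2.ne').neg
  have tD := tame (A := fun θ => -(θ.2.1)⁻¹) fun θ hθ => ((cv θ hθ).inv hθ.1.ne').neg
  have tL := tA.add hU hKU (tr.mul hU hKU tB)
  have tZ := tC.add hU hKU (tr.mul hU hKU tD)
  exact exists_rpow_mul_norm_fderiv_fderiv_le_of_tame_residual
    (f := fun i θ => fNE g θ i.1 i.2) hU hKU tL tZ ha (by positivity)
    (by positivity : 0 ≤ sl⁻¹ * Real.exp (su ^ 2 / (2 * sl ^ 2) + 1 / 2 + su⁻¹))
    (fun i θ hθ => fNE_eq_exp_mul g hθ.2 i.1 i.2)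
    (fun i θ hθ => fNE_le_exp g hsl hθ.2.1 hθ.2.2 i.1 i.2)

/-- Lemma 3, second bound: for the normal–truncated-normal and
normal–exponential pseudo conditional densities, with Θ the compact box and g(x,β)
twice differentiable in β, for every α > 0 there is a finite constant C with
f_θ^{α−1}(y|x) ‖∂²_{θθᵀ} f_θ(y|x)‖
  ≤ C (1 + sup_{θ∈Θ} ‖∂_β g(x,β) ∂_{βᵀ} g(x,β)‖ + sup_{θ∈Θ} ‖∂²_{ββᵀ} g(x,β)‖)
for all θ ∈ Θ, x, y (suprema in [0,∞]; the norm of the outer product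
∂_β g ∂_{βᵀ} g is ‖∂_β g‖²). -/
theorem density_hessian_bound {p q : ℕ} (g : (Fin p → ℝ) → (Fin q → ℝ) → ℝ)
    (hg1 : ∀ x, Differentiable ℝ (g x))
    (hg2 : ∀ x, Differentiable ℝ (fderiv ℝ (g x)))
    (a : ℝ) (ha : 0 < a)
    (bl bu ul uu sl su : ℝ) (hsl : 0 < sl) (hs : sl ≤ su) :
    (∃ C : ℝ≥0∞, C ≠ ⊤ ∧ ∀ θ ∈ boxNT q bl bu ul uu sl su, ∀ (x : Fin p → ℝ) (y : ℝ),
        ENNReal.ofReal (fNT g θ x y ^ (a - 1) * ‖fderiv ℝ (fderiv ℝ (fun t => fNT g t x y)) θ‖)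
          ≤ C * (1
              + (⨆ β ∈ Set.Icc (fun _ : Fin q => bl) (fun _ => bu),
                  ENNReal.ofReal (‖fderiv ℝ (g x) β‖ ^ 2))
              + ⨆ β ∈ Set.Icc (fun _ : Fin q => bl) (fun _ => bu),
                  ENNReal.ofReal ‖fderiv ℝ (fderiv ℝ (g x)) β‖))
    ∧ (∃ C : ℝ≥0∞, C ≠ ⊤ ∧ ∀ θ ∈ boxNE q bl bu sl su, ∀ (x : Fin p → ℝ) (y : ℝ),
        ENNReal.ofReal (fNE g θ x y ^ (a - 1) * ‖fderiv ℝ (fderiv ℝ (fun t => fNE g t x y)) θ‖)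
          ≤ C * (1
              + (⨆ β ∈ Set.Icc (fun _ : Fin q => bl) (fun _ => bu),
                  ENNReal.ofReal (‖fderiv ℝ (g x) β‖ ^ 2))
              + ⨆ β ∈ Set.Icc (fun _ : Fin q => bl) (fun _ => bu),
                  ENNReal.ofReal ‖fderiv ℝ (fderiv ℝ (g x)) β‖)) := by
  exact ⟨exists_ennreal_bound_of_residualWeights (fun _ hθ => hθ.1)
      (density_hessian_bound_fNT g hg1 hg2 ha bl bu ul uu hsl hs),
    exists_ennreal_bound_of_residualWeights (fun _ hθ => hθ.1)
      (density_hessian_bound_fNE g hg1 hg2 ha bl bu hsl hs)⟩
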